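/- Let ℓ₁ > 0. For t ∈ (0,1) and ε > 0, let f_{t,ε} : ℝ → ℝ denote the C² solution of f''(r) = k_{t,ε}(r)·f(r) with f(0) = f'(0) = ℓ₁ (where k_{t,ε} is the explicit bump function defined in the context); for ε = 0, let f_{t,0}(r) = ℓ₁·e^r for r ≥ 0 and f_{t,0}(r) = ℓ₁·cosh(r·√t) + (ℓ₁/√t)·sinh(r·√t) for r < 0. Let r₀(t,ε) denote the unique zero of f_{t,ε} and set m(t,ε) = f_{t,ε}'(r₀(t,ε)). Then the function m(t,ε) is continuous on (0,1) × [0,∞), and it is strictly decreasing in t for each fixed ε and strictly decreasing in ε for each fixed t. -/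

import Mathlib

/-- The smooth bump profile `z(u) = exp(-1/u² - 1/(u-1)²)` on `(0,1)`,
extended by `0` elsewhere. -/
noncomputable def zfun (u : ℝ) : ℝ :=
  if u ∈ Set.Ioo (0 : ℝ) 1 then Real.exp (-1 / u ^ 2 - 1 / (u - 1) ^ 2) else 0

/-- The explicit bump function `k_{t,ε}` of Futer–Kalfagianni–Purcell:
equal to `t` for `r ≤ -ε`, to `1` for `r ≥ -ε/2`, and interpolating
smoothly in between. -/
noncomputable def kbump (t ε r : ℝ) : ℝ :=
  if r ≤ -ε then t
  else if -ε / 2 ≤ r then 1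
  else t + (1 - t) * (∫ u in (0 : ℝ)..(2 + 2 * r / ε), zfun u) /
    (∫ u in (0 : ℝ)..1, zfun u)

/-- The normalized primitive of `zfun`, a continuous step from `0` to `1`. -/
noncomputable def zratio (x : ℝ) : ℝ :=
  (∫ u in (0 : ℝ)..x, zfun u) / ∫ u in (0 : ℝ)..1, zfun u

theorem zfun_nonneg (u : ℝ) : 0 ≤ zfun u := by
  unfold zfun; split_ifs <;> positivity

theorem zfun_pos {u : ℝ} (hu : u ∈ Set.Ioo (0 : ℝ) 1) : 0 < zfun u := by
  rw [zfun, if_pos hu]; positivity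

theorem zfun_le_one (u : ℝ) : zfun u ≤ 1 := by
  unfold zfun
  split_ifs
  · have h1 : 0 ≤ 1 / u ^ 2 := by positivity
    have h2 : 0 ≤ 1 / (u - 1) ^ 2 := by positivity
    rw [Real.exp_le_one_iff, neg_div]
    linarith
  · exact zero_le_one

theorem measurable_zfun : Measurable zfun := by
  unfold zfun
  exact Measurable.ite measurableSet_Ioo (by fun_prop) measurable_const

theorem intervalIntegrable_zfun (a b : ℝ) :
    IntervalIntegrable zfun MeasureTheory.volume a b := by
  refine (intervalIntegrable_const (c := (1 : ℝ))).mono_fun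
    measurable_zfun.aestronglyMeasurable (Filter.Eventually.of_forall fun u => ?_)
  simpa [abs_of_nonneg (zfun_nonneg u)] using zfun_le_one u

theorem integral_zfun_pos {a b : ℝ} (ha : 0 ≤ a) (hab : a < b) (hb : b ≤ 1) :
    0 < ∫ u in a..b, zfun u :=
  intervalIntegral.intervalIntegral_pos_of_pos_on (intervalIntegrable_zfun a b)
    (fun _ hx => zfun_pos ⟨ha.trans_lt hx.1, hx.2.trans_le hb⟩) hab

theorem continuous_zratio : Continuous zratio :=
  (intervalIntegral.continuous_primitive intervalIntegrable_zfun 0).div_const _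

theorem zratio_sub (x y : ℝ) :
    zratio y - zratio x = (∫ u in x..y, zfun u) / ∫ u in (0 : ℝ)..1, zfun u := by
  rw [zratio, zratio, ← sub_div, intervalIntegral.integral_interval_sub_left
    (intervalIntegrable_zfun _ _) (intervalIntegrable_zfun _ _)]

theorem zratio_mono : Monotone zratio := fun x y hxy => by
  have h1 := integral_zfun_pos le_rfl one_pos le_rfl
  have h2 : 0 ≤ ∫ u in x..y, zfun u :=
    intervalIntegral.integral_nonneg hxy fun u _ => zfun_nonneg u
  have := zratio_sub x y
  have : 0 ≤ zratio y - zratio x := by rw [this]; positivity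
  linarith

theorem zratio_strictMonoOn : StrictMonoOn zratio (Set.Icc 0 1) := fun x hx y hy hxy => by
  have h1 := integral_zfun_pos le_rfl one_pos le_rfl
  have h2 := integral_zfun_pos hx.1 hxy hy.2
  have := zratio_sub x y
  have : 0 < zratio y - zratio x := by rw [this]; positivity
  linarith

theorem zratio_of_nonpos {x : ℝ} (hx : x ≤ 0) : zratio x = 0 := by
  have : ∫ u in (0 : ℝ)..x, zfun u = 0 := by
    refine intervalIntegral.integral_zero_ae (Filter.Eventually.of_forall fun u hu => ?_)
    rw [Set.uIoc_of_ge hx] at hu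
    exact if_neg fun h => absurd h.1 (not_lt.2 hu.2)
  rw [zratio, this, zero_div]

theorem zratio_one : zratio 1 = 1 :=
  div_self (integral_zfun_pos le_rfl one_pos le_rfl).ne'

theorem zratio_of_one_le {x : ℝ} (hx : 1 ≤ x) : zratio x = 1 := by
  have h : ∫ u in (1 : ℝ)..x, zfun u = 0 := by
    refine intervalIntegral.integral_zero_ae (Filter.Eventually.of_forall fun u hu => ?_)
    rw [Set.uIoc_of_le hx] at hu
    exact if_neg fun h => absurd h.2 (not_lt.2 hu.1.le)
  have := zratio_sub 1 x
  rw [h, zero_div, zratio_one] at this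
  linarith

theorem zratio_nonneg (x : ℝ) : 0 ≤ zratio x := by
  rcases le_total x 0 with h | h
  · exact (zratio_of_nonpos h).ge
  · exact (zratio_of_nonpos le_rfl).ge.trans (zratio_mono h)

theorem zratio_le_one (x : ℝ) : zratio x ≤ 1 := by
  rcases le_total x 1 with h | h
  · exact (zratio_mono h).trans zratio_one.le
  · exact (zratio_of_one_le h).le

theorem zratio_lt_zratio {x y : ℝ} (hx : x < 1) (hy : 0 < y) (hxy : x < y) :
    zratio x < zratio y :=
  calc zratio x ≤ zratio (max x 0) := zratio_mono (le_max_left _ _)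
    _ < zratio (min y 1) := zratio_strictMonoOn
        ⟨le_max_right _ _, (max_lt hx one_pos).le⟩ ⟨(lt_min hy one_pos).le, min_le_right _ _⟩
        (max_lt (lt_min hxy hx) (lt_min hy one_pos))
    _ ≤ zratio y := zratio_mono (min_le_left _ _)

theorem kbump_of_pos (t r : ℝ) {ε : ℝ} (hε : 0 < ε) :
    kbump t ε r = t + (1 - t) * zratio (2 + 2 * r / ε) := by
  unfold kbump
  split_ifs with h1 h2
  · rw [zratio_of_nonpos, mul_zero, add_zero]
    have : 2 * r / ε ≤ -2 := by rw [div_le_iff₀ hε]; linarith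
    linarith
  · rw [zratio_of_one_le]
    · ring
    have : -1 ≤ 2 * r / ε := by rw [le_div_iff₀ hε]; linarith
    linarith
  · rw [zratio, mul_div_assoc]

theorem kbump_of_le {t ε r : ℝ} (h : r ≤ -ε) : kbump t ε r = t := if_pos h

theorem kbump_zero (t : ℝ) {r : ℝ} (hr : r ≤ 0) : kbump t 0 r = t :=
  kbump_of_le (by simpa using hr)

theorem kbump_eq_one {t ε r : ℝ} (hε : 0 < ε) (hr : -ε / 2 ≤ r) : kbump t ε r = 1 := by
  rw [kbump, if_neg (by linarith), if_pos hr]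

theorem le_kbump {t ε r : ℝ} (ht : t ∈ Set.Ioo (0 : ℝ) 1) (hε : 0 ≤ ε) (hr : r ≤ 0) :
    t ≤ kbump t ε r := by
  rcases hε.eq_or_lt with rfl | h
  · exact (kbump_zero t hr).ge
  · rw [kbump_of_pos t r h]
    nlinarith [mul_nonneg (sub_nonneg.2 ht.2.le) (zratio_nonneg (2 + 2 * r / ε))]

theorem kbump_le_one {t ε r : ℝ} (ht : t ∈ Set.Ioo (0 : ℝ) 1) (hε : 0 ≤ ε) (hr : r ≤ 0) :
    kbump t ε r ≤ 1 := by
  rcases hε.eq_or_lt with rfl | h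
  · exact (kbump_zero t hr).le.trans ht.2.le
  · rw [kbump_of_pos t r h]
    nlinarith [mul_nonneg (sub_nonneg.2 ht.2.le) (sub_nonneg.2 (zratio_le_one (2 + 2 * r / ε)))]

theorem kbump_mono_left {t s ε r : ℝ} (hts : t ≤ s) (hε : 0 ≤ ε) (hr : r ≤ 0) :
    kbump t ε r ≤ kbump s ε r := by
  rcases hε.eq_or_lt with rfl | h
  · rwa [kbump_zero t hr, kbump_zero s hr]
  · rw [kbump_of_pos t r h, kbump_of_pos s r h]
    nlinarith [mul_nonneg (sub_nonneg.2 hts) (sub_nonneg.2 (zratio_le_one (2 + 2 * r / ε)))]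

theorem step_lt_one {ε r : ℝ} (hε : 0 < ε) (hr : r < -ε / 2) : 2 + 2 * r / ε < 1 := by
  have : 2 * r / ε < -1 := by rw [div_lt_iff₀ hε]; linarith
  linarith

theorem step_pos {ε r : ℝ} (hε : 0 < ε) (hr : -ε < r) : 0 < 2 + 2 * r / ε := by
  have : -2 < 2 * r / ε := by rw [lt_div_iff₀ hε]; linarith
  linarith

theorem kbump_lt_one {t ε r : ℝ} (ht : t ∈ Set.Ioo (0 : ℝ) 1) (hε : 0 ≤ ε) (hr : r < -ε / 2) :
    kbump t ε r < 1 := by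
  rcases hε.eq_or_lt with rfl | h
  · exact (kbump_zero t (by linarith)).trans_lt ht.2
  · have := zratio_lt_zratio (step_lt_one h hr) one_pos (step_lt_one h hr)
    rw [zratio_one] at this
    rw [kbump_of_pos t r h]
    nlinarith [mul_pos (sub_pos.2 ht.2) (sub_pos.2 this)]

theorem kbump_lt_left {t s ε r : ℝ} (hts : t < s) (hε : 0 ≤ ε) (hr : r < -ε / 2) :
    kbump t ε r < kbump s ε r := by
  rcases hε.eq_or_lt with rfl | h
  · rwa [kbump_zero t (by linarith), kbump_zero s (by linarith)]
  · have := zratio_lt_zratio (step_lt_one h hr) one_pos (step_lt_one h hr)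
    rw [zratio_one] at this
    rw [kbump_of_pos t r h, kbump_of_pos s r h]
    nlinarith [mul_pos (sub_pos.2 hts) (sub_pos.2 this)]

theorem step_mono {ε δ r : ℝ} (hε : 0 < ε) (hεδ : ε ≤ δ) (hr : r ≤ 0) :
    2 + 2 * r / ε ≤ 2 + 2 * r / δ := by
  have hδ := hε.trans_le hεδ
  have : 2 * r / ε ≤ 2 * r / δ := by
    rw [div_le_div_iff₀ hε hδ]; nlinarith
  linarith

theorem step_lt_step {ε δ r : ℝ} (hε : 0 < ε) (hεδ : ε < δ) (hr : r < 0) :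
    2 + 2 * r / ε < 2 + 2 * r / δ := by
  have hδ := hε.trans hεδ
  have : 2 * r / ε < 2 * r / δ := by
    rw [div_lt_div_iff₀ hε hδ]; nlinarith
  linarith

theorem kbump_mono_right {t ε δ r : ℝ} (ht : t ∈ Set.Ioo (0 : ℝ) 1) (hε : 0 ≤ ε) (hεδ : ε ≤ δ)
    (hr : r ≤ 0) : kbump t ε r ≤ kbump t δ r := by
  rcases hε.eq_or_lt with rfl | h
  · exact (kbump_zero t hr).le.trans (le_kbump ht hεδ hr)
  · rw [kbump_of_pos t r h, kbump_of_pos t r (h.trans_le hεδ)]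
    have := mul_le_mul_of_nonneg_left (zratio_mono (step_mono h hεδ hr)) (sub_nonneg.2 ht.2.le)
    linarith

theorem kbump_lt_right {t ε δ r : ℝ} (ht : t ∈ Set.Ioo (0 : ℝ) 1) (hε : 0 ≤ ε) (hεδ : ε < δ)
    (hr : r < -ε / 2) (hr' : -δ < r) : kbump t ε r < kbump t δ r := by
  have hδ := hε.trans_lt hεδ
  have h1t := sub_pos.2 ht.2
  rcases hε.eq_or_lt with rfl | h
  · rw [kbump_zero t (by linarith), kbump_of_pos t r hδ]
    have := zratio_lt_zratio one_pos (step_pos hδ hr') (step_pos hδ hr')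
    rw [zratio_of_nonpos le_rfl] at this
    nlinarith [mul_pos h1t this]
  · rw [kbump_of_pos t r h, kbump_of_pos t r hδ]
    have := mul_lt_mul_of_pos_left (zratio_lt_zratio (step_lt_one h hr) (step_pos hδ hr')
      (step_lt_step h hεδ (by linarith))) h1t
    linarith

theorem continuousOn_kbump (t : ℝ) {ε : ℝ} (hε : 0 ≤ ε) :
    ContinuousOn (kbump t ε) (Set.Iic 0) := by
  rcases hε.eq_or_lt with rfl | h
  · exact continuousOn_const.congr fun r hr => kbump_zero t hr
  · have : kbump t ε = fun r => t + (1 - t) * zratio (2 + 2 * r / ε) :=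
      funext fun r => kbump_of_pos t r h
    rw [this]
    exact (continuous_const.add (continuous_const.mul
      (continuous_zratio.comp (by fun_prop)))).continuousOn

theorem continuousWithinAt_kbump {r : ℝ} (hr : r < 0) {p : ℝ × ℝ} (hp : 0 ≤ p.2) :
    ContinuousWithinAt (fun q : ℝ × ℝ => kbump q.1 q.2 r) (Set.Ioo 0 1 ×ˢ Set.Ici 0) p := by
  refine ContinuousAt.continuousWithinAt ?_
  rcases hp.eq_or_lt with h | h
  · have : (fun q : ℝ × ℝ => kbump q.1 q.2 r) =ᶠ[nhds p] fun q => q.1 := by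
      filter_upwards [continuous_snd.continuousAt.eventually_lt
        (continuousAt_const (y := -r)) (by linarith : p.2 < -r)] with q hq
      exact kbump_of_le (by linarith)
    exact continuousAt_fst.congr this.symm
  · have : (fun q : ℝ × ℝ => kbump q.1 q.2 r) =ᶠ[nhds p]
        fun q => q.1 + (1 - q.1) * zratio (2 + 2 * r / q.2) := by
      filter_upwards [continuousAt_const.eventually_lt continuous_snd.continuousAt h] with q hq
      exact kbump_of_pos _ _ hq
    refine ContinuousAt.congr ?_ this.symm
    have h2 : ContinuousAt (fun q : ℝ × ℝ => 2 + 2 * r / q.2) p :=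
      continuousAt_const.add (continuousAt_const.div continuousAt_snd h.ne')
    exact continuousAt_fst.add ((continuousAt_const.sub continuousAt_fst).mul
      (continuous_zratio.continuousAt.comp h2))

theorem intervalIntegrable_kbump (t : ℝ) {ε a : ℝ} (hε : 0 ≤ ε) (ha : a ≤ 0) :
    IntervalIntegrable (kbump t ε) MeasureTheory.volume 0 a := by
  refine ((continuousOn_kbump t hε).mono ?_).intervalIntegrable
  rw [Set.uIcc_of_ge ha]
  exact Set.Icc_subset_Iic_self

theorem continuousWithinAt_integral_kbump {a : ℝ} (ha : a ≤ 0) {p : ℝ × ℝ} (hp : 0 ≤ p.2) :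
    ContinuousWithinAt (fun q : ℝ × ℝ => ∫ r in (0 : ℝ)..a, kbump q.1 q.2 r)
      (Set.Ioo 0 1 ×ˢ Set.Ici 0) p := by
  refine intervalIntegral.tendsto_integral_filter_of_dominated_convergence (fun _ => 1) ?_ ?_
    intervalIntegrable_const ?_
  · filter_upwards [self_mem_nhdsWithin] with q hq
    rw [Set.uIoc_of_ge ha]
    exact ((continuousOn_kbump q.1 hq.2).mono Set.Ioc_subset_Iic_self).aestronglyMeasurable
      measurableSet_Ioc
  · filter_upwards [self_mem_nhdsWithin] with q hq
    refine Filter.Eventually.of_forall fun r hr => ?_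
    rw [Set.uIoc_of_ge ha] at hr
    have := le_kbump hq.1 hq.2 hr.2
    rw [Real.norm_of_nonneg (hq.1.1.le.trans this)]
    exact kbump_le_one hq.1 hq.2 hr.2
  · filter_upwards [MeasureTheory.Measure.ae_ne MeasureTheory.volume (0 : ℝ)] with r h0 hr
    rw [Set.uIoc_of_ge ha] at hr
    exact continuousWithinAt_kbump (lt_of_le_of_ne hr.2 h0) hp

theorem hasDerivAt_integral_kbump (t : ℝ) {ε r : ℝ} (hε : 0 ≤ ε) (hr : r < 0) :
    HasDerivAt (fun x => ∫ u in (0 : ℝ)..x, kbump t ε u) (kbump t ε r) r := by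
  have hc := (continuousOn_kbump t hε).mono Set.Iio_subset_Iic_self
  exact intervalIntegral.integral_hasDerivAt_right (intervalIntegrable_kbump t hε hr.le)
    (hc.stronglyMeasurableAtFilter isOpen_Iio _ hr)
    (hc.continuousAt (Iio_mem_nhds hr))

theorem continuousOn_integral_kbump (t : ℝ) {ε a : ℝ} (hε : 0 ≤ ε) (ha : a ≤ 0) :
    ContinuousOn (fun x => ∫ u in (0 : ℝ)..x, kbump t ε u) (Set.Icc a 0) := by
  have := intervalIntegral.continuousOn_primitive_interval'
    (intervalIntegrable_kbump t hε ha) (Set.left_mem_uIcc (a := (0 : ℝ)) (b := a))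
  rwa [Set.uIcc_of_ge ha] at this

section Monotonicity

variable {F F' : ℝ → ℝ} {a b : ℝ}

theorem monotoneOn_Icc_of_hasDerivAt_nonneg (hc : ContinuousOn F (Set.Icc a b))
    (hd : ∀ x ∈ Set.Ioo a b, HasDerivAt F (F' x) x) (hn : ∀ x ∈ Set.Ioo a b, 0 ≤ F' x) :
    MonotoneOn F (Set.Icc a b) :=
  monotoneOn_of_hasDerivWithinAt_nonneg (convex_Icc a b) hc
    (fun x hx => (hd x (by rwa [interior_Icc] at hx)).hasDerivWithinAt)
    (fun x hx => hn x (by rwa [interior_Icc] at hx))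

theorem antitoneOn_Icc_of_hasDerivAt_nonpos (hc : ContinuousOn F (Set.Icc a b))
    (hd : ∀ x ∈ Set.Ioo a b, HasDerivAt F (F' x) x) (hn : ∀ x ∈ Set.Ioo a b, F' x ≤ 0) :
    AntitoneOn F (Set.Icc a b) :=
  antitoneOn_of_hasDerivWithinAt_nonpos (convex_Icc a b) hc
    (fun x hx => (hd x (by rwa [interior_Icc] at hx)).hasDerivWithinAt)
    (fun x hx => hn x (by rwa [interior_Icc] at hx))

theorem lt_of_hasDerivAt_nonneg_of_pos {c : ℝ} (hc : ContinuousOn F (Set.Icc a b))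
    (hd : ∀ x ∈ Set.Ioo a b, HasDerivAt F (F' x) x) (hn : ∀ x ∈ Set.Ioo a b, 0 ≤ F' x)
    (hab : c ∈ Set.Ioo a b) (hpos : 0 < F' c) : F a < F b := by
  have hm := monotoneOn_Icc_of_hasDerivAt_nonneg hc hd hn
  have ha : a ∈ Set.Icc a b := ⟨le_rfl, (hab.1.trans hab.2).le⟩
  have hb : b ∈ Set.Icc a b := ⟨(hab.1.trans hab.2).le, le_rfl⟩
  refine lt_of_le_of_ne (hm ha hb ha.2) fun he => hpos.ne' ?_
  refine (hd c hab).unique ((hasDerivAt_const c (F a)).congr_of_eventuallyEq ?_)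
  filter_upwards [Ioo_mem_nhds hab.1 hab.2] with x hx
  have hx' := Set.Ioo_subset_Icc_self hx
  exact le_antisymm (he ▸ hm hx' hb hx.2.le) (hm ha hx' hx.1.le)

theorem lt_of_hasDerivAt_nonpos_of_neg {c : ℝ} (hc : ContinuousOn F (Set.Icc a b))
    (hd : ∀ x ∈ Set.Ioo a b, HasDerivAt F (F' x) x) (hn : ∀ x ∈ Set.Ioo a b, F' x ≤ 0)
    (hab : c ∈ Set.Ioo a b) (hneg : F' c < 0) : F b < F a := by
  have := lt_of_hasDerivAt_nonneg_of_pos (F := fun x => -F x) (F' := fun x => -F' x) hc.neg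
    (fun x hx => (hd x hx).neg) (fun x hx => neg_nonneg.2 (hn x hx)) hab (neg_pos.2 hneg)
  linarith

end Monotonicity

/-- `g` solves `g'' = k g` on `(-∞, 0)` with `g 0 = g' 0 = ℓ`, and `a` is its largest zero
there. -/
structure IsShot (ℓ : ℝ) (k g g' : ℝ → ℝ) (a : ℝ) : Prop where
  cont : ContinuousOn g (Set.Iic 0)
  cont' : ContinuousOn g' (Set.Iic 0)
  hasDeriv : ∀ r < 0, HasDerivAt g (g' r) r
  hasDeriv' : ∀ r < 0, HasDerivAt g' (k r * g r) r
  at_zero : g 0 = ℓ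
  at_zero' : g' 0 = ℓ
  neg : a < 0
  root : g a = 0
  pos : ∀ r, a < r → r ≤ 0 → 0 < g r
  k_nonneg : ∀ r < 0, 0 ≤ k r
  k_le_one : ∀ r < 0, k r ≤ 1

namespace IsShot

variable {ℓ : ℝ} {k g g' : ℝ → ℝ} {a : ℝ}

theorem contIcc (h : IsShot ℓ k g g' a) (c : ℝ) : ContinuousOn g (Set.Icc c 0) :=
  h.cont.mono Set.Icc_subset_Iic_self

theorem contIcc' (h : IsShot ℓ k g g' a) (c : ℝ) : ContinuousOn g' (Set.Icc c 0) :=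
  h.cont'.mono Set.Icc_subset_Iic_self

theorem nonneg (h : IsShot ℓ k g g' a) {r : ℝ} (h1 : a ≤ r) (h2 : r ≤ 0) : 0 ≤ g r := by
  rcases h1.eq_or_lt with rfl | h1
  · exact h.root.ge
  · exact (h.pos r h1 h2).le

theorem level_pos (h : IsShot ℓ k g g' a) : 0 < ℓ := h.at_zero ▸ h.pos 0 h.neg le_rfl

/-- `(g' - g) eʳ` has derivative `(k - 1) g eʳ`. -/
theorem slope_pos (h : IsShot ℓ k g g' a) {c : ℝ} (hc : c ∈ Set.Ioo a 0) (hk : k c < 1) :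
    0 < g' a := by
  have := lt_of_hasDerivAt_nonpos_of_neg (F := fun r => (g' r - g r) * Real.exp r)
    (F' := fun r => (k r - 1) * g r * Real.exp r) (c := c)
    (((h.contIcc' a).sub (h.contIcc a)).mul Real.continuous_exp.continuousOn)
    (fun r hr => by
      refine (((h.hasDeriv' r hr.2).sub (h.hasDeriv r hr.2)).mul
        (Real.hasDerivAt_exp r)).congr_deriv ?_
      simp only [Pi.sub_apply]
      ring)
    (fun r hr => mul_nonpos_of_nonpos_of_nonneg (mul_nonpos_of_nonpos_of_nonneg
      (sub_nonpos.2 (h.k_le_one r hr.2)) (h.pos r hr.1 hr.2.le).le) (Real.exp_pos r).le) hc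
    (mul_neg_of_neg_of_pos (mul_neg_of_neg_of_pos (sub_neg.2 hk) (h.pos c hc.1 hc.2.le))
      (Real.exp_pos c))
  simp only [h.at_zero, h.at_zero', h.root, sub_self, zero_mul, sub_zero] at this
  exact pos_of_mul_pos_left this (Real.exp_pos a).le

theorem monotoneOn_slope (h : IsShot ℓ k g g' a) : MonotoneOn g' (Set.Icc a 0) :=
  monotoneOn_Icc_of_hasDerivAt_nonneg (h.contIcc' a) (fun r hr => h.hasDeriv' r hr.2)
    fun r hr => mul_nonneg (h.k_nonneg r hr.2) (h.pos r hr.1 hr.2.le).le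

theorem monotoneOn (h : IsShot ℓ k g g' a) (hm : 0 ≤ g' a) : MonotoneOn g (Set.Icc a 0) :=
  monotoneOn_Icc_of_hasDerivAt_nonneg (h.contIcc a) (fun r hr => h.hasDeriv r hr.2)
    fun _ hr => hm.trans (h.monotoneOn_slope ⟨le_rfl, h.neg.le⟩ (Set.Ioo_subset_Icc_self hr)
      hr.1.le)

theorem le_level (h : IsShot ℓ k g g' a) (hm : 0 ≤ g' a) {r : ℝ} (h1 : a ≤ r) (h2 : r ≤ 0) :
    g r ≤ ℓ :=
  h.at_zero ▸ h.monotoneOn hm ⟨h1, h2⟩ ⟨h.neg.le, le_rfl⟩ h2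

/-- `g' ^ 2 - g ^ 2` has derivative `2 (k - 1) g g'`. -/
theorem slope_le (h : IsShot ℓ k g g' a) (hm : 0 ≤ g' a) {c : ℝ} (h1 : a ≤ c) (h2 : c ≤ 0) :
    g' c ≤ g' a + g c := by
  have hanti : AntitoneOn (fun r => g' r ^ 2 - g r ^ 2) (Set.Icc a 0) := by
    refine antitoneOn_Icc_of_hasDerivAt_nonpos (F' := fun r => 2 * (k r - 1) * (g r * g' r))
      (((h.contIcc' a).pow 2).sub ((h.contIcc a).pow 2)) (fun r hr => ?_) (fun r hr => ?_)
    · refine (((h.hasDeriv' r hr.2).pow 2).sub ((h.hasDeriv r hr.2).pow 2)).congr_deriv ?_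
      norm_num
      ring
    · have hs : 0 ≤ g' r := hm.trans (h.monotoneOn_slope ⟨le_rfl, h.neg.le⟩
        (Set.Ioo_subset_Icc_self hr) hr.1.le)
      have hg := (h.pos r hr.1 hr.2.le).le
      have hk := h.k_le_one r hr.2
      nlinarith [mul_nonneg (sub_nonneg.2 hk) (mul_nonneg hg hs)]
  have h3 := hanti ⟨le_rfl, h.neg.le⟩ ⟨h1, h2⟩ h1
  simp only [h.root] at h3
  have h4 := h.nonneg h1 h2
  refine abs_le_of_sq_le_sq' ?_ (by positivity) |>.2
  nlinarith [mul_nonneg hm h4]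

variable {k₁ g₁ s₁ k₂ g₂ s₂ : ℝ → ℝ} {a₁ a₂ : ℝ}

theorem hasDerivAt_wronskian (h₁ : IsShot ℓ k₁ g₁ s₁ a₁) (h₂ : IsShot ℓ k₂ g₂ s₂ a₂) {r : ℝ}
    (hr : r < 0) : HasDerivAt (fun r => s₁ r * g₂ r - g₁ r * s₂ r)
      ((k₁ r - k₂ r) * (g₁ r * g₂ r)) r := by
  refine (((h₁.hasDeriv' r hr).mul (h₂.hasDeriv r hr)).sub
    ((h₁.hasDeriv r hr).mul (h₂.hasDeriv' r hr))).congr_deriv ?_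
  ring

theorem continuousOn_wronskian (h₁ : IsShot ℓ k₁ g₁ s₁ a₁) (h₂ : IsShot ℓ k₂ g₂ s₂ a₂)
    (c : ℝ) : ContinuousOn (fun r => s₁ r * g₂ r - g₁ r * s₂ r) (Set.Icc c 0) :=
  ((h₁.contIcc' c).mul (h₂.contIcc c)).sub ((h₁.contIcc c).mul (h₂.contIcc' c))

theorem le_of_le_of_lt (h₁ : IsShot ℓ k₁ g₁ s₁ a₁) (h₂ : IsShot ℓ k₂ g₂ s₂ a₂)
    (hk : ∀ r < 0, k₁ r ≤ k₂ r) {c : ℝ} (hc₁ : a₁ < c) (hc₂ : a₂ ≤ c) (hc : c ≤ 0) :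
    g₁ c ≤ g₂ c := by
  have hW : AntitoneOn (fun r => s₁ r * g₂ r - g₁ r * s₂ r) (Set.Icc c 0) :=
    antitoneOn_Icc_of_hasDerivAt_nonpos (h₁.continuousOn_wronskian h₂ c)
      (fun r hr => h₁.hasDerivAt_wronskian h₂ hr.2)
      fun r hr => mul_nonpos_of_nonpos_of_nonneg (sub_nonpos.2 (hk r hr.2))
        (mul_nonneg (h₁.nonneg (hc₁.le.trans hr.1.le) hr.2.le)
          (h₂.nonneg (hc₂.trans hr.1.le) hr.2.le))
  have hpos : ∀ r ∈ Set.Icc c 0, 0 < g₁ r := fun r hr => h₁.pos r (hc₁.trans_le hr.1) hr.2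
  have hQ : AntitoneOn (fun r => g₂ r / g₁ r) (Set.Icc c 0) := by
    refine antitoneOn_Icc_of_hasDerivAt_nonpos
      ((h₂.contIcc c).div (h₁.contIcc c) fun r hr => (hpos r hr).ne')
      (fun r hr => (h₂.hasDeriv r hr.2).div (h₁.hasDeriv r hr.2)
        (hpos r (Set.Ioo_subset_Icc_self hr)).ne') fun r hr => ?_
    have := hW (Set.Ioo_subset_Icc_self hr) ⟨hc, le_rfl⟩ hr.2.le
    simp only [h₁.at_zero, h₁.at_zero', h₂.at_zero, h₂.at_zero', sub_self] at this
    exact div_nonpos_of_nonpos_of_nonneg (by linarith) (sq_nonneg _)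
  have := hQ ⟨le_rfl, hc⟩ ⟨hc, le_rfl⟩ hc
  simp only [h₁.at_zero, h₂.at_zero, div_self h₁.level_pos.ne'] at this
  rwa [le_div_iff₀ (hpos c ⟨le_rfl, hc⟩), one_mul] at this

theorem root_le (h₁ : IsShot ℓ k₁ g₁ s₁ a₁) (h₂ : IsShot ℓ k₂ g₂ s₂ a₂)
    (hk : ∀ r < 0, k₁ r ≤ k₂ r) : a₂ ≤ a₁ := by
  by_contra! hlt
  have := h₁.le_of_le_of_lt h₂ hk hlt le_rfl h₂.neg.le
  rw [h₂.root] at this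
  exact this.not_gt (h₁.pos a₂ hlt h₂.neg.le)

theorem le_of_le (h₁ : IsShot ℓ k₁ g₁ s₁ a₁) (h₂ : IsShot ℓ k₂ g₂ s₂ a₂)
    (hk : ∀ r < 0, k₁ r ≤ k₂ r) {c : ℝ} (hc₁ : a₁ ≤ c) (hc : c ≤ 0) : g₁ c ≤ g₂ c := by
  have ha := h₁.root_le h₂ hk
  rcases hc₁.eq_or_lt with rfl | h
  · rw [h₁.root]
    exact h₂.nonneg ha hc
  · exact h₁.le_of_le_of_lt h₂ hk h (ha.trans hc₁) hc

theorem deriv_sub_nonneg (h₁ : IsShot ℓ k₁ g₁ s₁ a₁) (h₂ : IsShot ℓ k₂ g₂ s₂ a₂)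
    (hk : ∀ r < 0, k₁ r ≤ k₂ r) {r : ℝ} (hr₁ : a₁ < r) (hr : r < 0) :
    0 ≤ k₂ r * g₂ r - k₁ r * g₁ r :=
  sub_nonneg.2 (mul_le_mul (hk r hr) (h₁.le_of_le h₂ hk hr₁.le hr.le) (h₁.pos r hr₁ hr.le).le
    (h₂.k_nonneg r hr))

theorem slope_le_slope_right (h₁ : IsShot ℓ k₁ g₁ s₁ a₁) (h₂ : IsShot ℓ k₂ g₂ s₂ a₂)
    (hk : ∀ r < 0, k₁ r ≤ k₂ r) {r : ℝ} (hr₁ : a₁ ≤ r) (hr : r ≤ 0) : s₂ r ≤ s₁ r := by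
  have := monotoneOn_Icc_of_hasDerivAt_nonneg ((h₂.contIcc' a₁).sub (h₁.contIcc' a₁))
    (fun r hr => (h₂.hasDeriv' r hr.2).sub (h₁.hasDeriv' r hr.2))
    (fun r hr => h₁.deriv_sub_nonneg h₂ hk hr.1 hr.2) ⟨hr₁, hr⟩ ⟨h₁.neg.le, le_rfl⟩ hr
  simp only [h₁.at_zero', h₂.at_zero', Pi.sub_apply, sub_self] at this
  linarith

theorem slope_le_slope (h₁ : IsShot ℓ k₁ g₁ s₁ a₁) (h₂ : IsShot ℓ k₂ g₂ s₂ a₂)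
    (hk : ∀ r < 0, k₁ r ≤ k₂ r) : s₂ a₂ ≤ s₁ a₁ := by
  have ha := h₁.root_le h₂ hk
  exact (h₂.monotoneOn_slope ⟨le_rfl, h₂.neg.le⟩ ⟨ha, h₁.neg.le⟩ ha).trans
    (h₁.slope_le_slope_right h₂ hk le_rfl h₁.neg.le)

theorem slope_lt_slope (h₁ : IsShot ℓ k₁ g₁ s₁ a₁) (h₂ : IsShot ℓ k₂ g₂ s₂ a₂)
    (hk : ∀ r < 0, k₁ r ≤ k₂ r) {c : ℝ} (hc : c ∈ Set.Ioo a₁ 0) (hlt : k₁ c < k₂ c) :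
    s₂ a₂ < s₁ a₁ := by
  have ha := h₁.root_le h₂ hk
  refine (h₂.monotoneOn_slope ⟨le_rfl, h₂.neg.le⟩ ⟨ha, h₁.neg.le⟩ ha).trans_lt ?_
  have := lt_of_hasDerivAt_nonneg_of_pos ((h₂.contIcc' a₁).sub (h₁.contIcc' a₁))
    (fun r hr => (h₂.hasDeriv' r hr.2).sub (h₁.hasDeriv' r hr.2))
    (fun r hr => h₁.deriv_sub_nonneg h₂ hk hr.1 hr.2) hc
    (sub_pos.2 (mul_lt_mul hlt (h₁.le_of_le h₂ hk hc.1.le hc.2.le) (h₁.pos c hc.1 hc.2.le)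
      (h₂.k_nonneg c hc.2)))
  simp only [h₁.at_zero', h₂.at_zero', Pi.sub_apply, sub_self] at this
  linarith

theorem slope_sub_le (h₁ : IsShot ℓ k₁ g₁ s₁ a₁) (h₂ : IsShot ℓ k₂ g₂ s₂ a₂)
    (hk : ∀ r < 0, k₁ r ≤ k₂ r) (hm : 0 ≤ s₂ a₂) {P : ℝ → ℝ}
    (hPc : ContinuousOn P (Set.Icc a₁ 0)) (hP0 : P 0 = 0)
    (hP : ∀ r < 0, HasDerivAt P (k₂ r - k₁ r) r) {M R : ℝ} (hM : 0 < M) (hM₁ : M ≤ s₁ a₁)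
    (hR : -a₁ ≤ R) :
    s₁ a₁ - s₂ a₂ ≤ (ℓ + ℓ ^ 2 / M * (1 + R)) * -P a₁ := by
  have hℓ := h₁.level_pos
  have ha := h₁.root_le h₂ hk
  have ha₁ : a₁ ∈ Set.Icc a₁ 0 := ⟨le_rfl, h₁.neg.le⟩
  have h0 : (0 : ℝ) ∈ Set.Icc a₁ 0 := ⟨h₁.neg.le, le_rfl⟩
  have hm₁ : 0 ≤ s₁ a₁ := hM.le.trans hM₁
  have hβ₀ : 0 ≤ g₂ a₁ := h₂.nonneg ha h₁.neg.le
  have hle₁ : ∀ r ∈ Set.Ioo a₁ 0, g₁ r ≤ ℓ := fun r hr => h₁.le_level hm₁ hr.1.le hr.2.le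
  have hle₂ : ∀ r ∈ Set.Ioo a₁ 0, g₂ r ≤ ℓ := fun r hr =>
    h₂.le_level hm (ha.trans hr.1.le) hr.2.le
  have hW : s₁ a₁ * g₂ a₁ ≤ ℓ ^ 2 * -P a₁ := by
    have := monotoneOn_Icc_of_hasDerivAt_nonneg
      (F := fun r => (s₁ r * g₂ r - g₁ r * s₂ r) + ℓ ^ 2 * P r)
      ((h₁.continuousOn_wronskian h₂ a₁).add (continuousOn_const.mul hPc))
      (fun r hr => (h₁.hasDerivAt_wronskian h₂ hr.2).add ((hP r hr.2).const_mul (ℓ ^ 2)))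
      (fun r hr => by
        have h3 : g₁ r * g₂ r ≤ ℓ * ℓ := mul_le_mul (hle₁ r hr) (hle₂ r hr)
          (h₂.nonneg (ha.trans hr.1.le) hr.2.le) hℓ.le
        nlinarith [mul_nonneg (sub_nonneg.2 (hk r hr.2)) (sub_nonneg.2 h3)]) ha₁ h0 h₁.neg.le
    simp only [h₁.at_zero, h₁.at_zero', h₂.at_zero, h₂.at_zero', h₁.root, hP0] at this
    linarith
  have hD : ∀ r ∈ Set.Ioo a₁ 0, g₂ r - g₁ r ≤ g₂ a₁ := fun r hr => by
    have := antitoneOn_Icc_of_hasDerivAt_nonpos ((h₂.contIcc a₁).sub (h₁.contIcc a₁))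
      (fun r hr => (h₂.hasDeriv r hr.2).sub (h₁.hasDeriv r hr.2))
      (fun r hr => sub_nonpos.2 (h₁.slope_le_slope_right h₂ hk hr.1.le hr.2.le))
      ha₁ (Set.Ioo_subset_Icc_self hr) hr.1.le
    simpa [h₁.root] using this
  have hS : s₁ a₁ - s₂ a₁ ≤ ℓ * -P a₁ + g₂ a₁ * -a₁ := by
    have := antitoneOn_Icc_of_hasDerivAt_nonpos
      (F := fun r => (s₂ r - s₁ r) - ℓ * P r - g₂ a₁ * r)
      ((((h₂.contIcc' a₁).sub (h₁.contIcc' a₁)).sub (continuousOn_const.mul hPc)).sub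
        (continuousOn_const.mul continuousOn_id))
      (fun r hr => (((h₂.hasDeriv' r hr.2).sub (h₁.hasDeriv' r hr.2)).sub
        ((hP r hr.2).const_mul ℓ)).sub ((hasDerivAt_id r).const_mul (g₂ a₁)))
      (fun r hr => by
        have h3 := mul_nonneg (sub_nonneg.2 (hk r hr.2)) (sub_nonneg.2 (hle₂ r hr))
        have h4 := mul_le_mul (h₁.k_le_one r hr.2) (hD r hr)
          (sub_nonneg.2 (h₁.le_of_le h₂ hk hr.1.le hr.2.le)) zero_le_one
        nlinarith) ha₁ h0 h₁.neg.le
    simp only [h₁.at_zero', h₂.at_zero', hP0] at this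
    linarith
  have hβ : g₂ a₁ ≤ ℓ ^ 2 / M * -P a₁ := by
    rw [div_mul_eq_mul_div, le_div_iff₀ hM]
    nlinarith [mul_le_mul_of_nonneg_right hM₁ hβ₀]
  have h5 := h₂.slope_le hm ha h₁.neg.le
  have hR₀ : 0 ≤ 1 + R := by linarith [h₁.neg]
  nlinarith [mul_le_mul_of_nonneg_left hR hβ₀, mul_le_mul_of_nonneg_right hβ hR₀]

end IsShot

theorem pos_of_root_unique {f : ℝ → ℝ} {a : ℝ} (hc : ContinuousOn f (Set.Iic 0)) (h0 : 0 < f 0)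
    (hu : ∀ r, f r = 0 → r ≤ 0 → r = a) {r : ℝ} (har : a < r) (hr : r ≤ 0) : 0 < f r := by
  by_contra! hle
  obtain ⟨x, hx, hfx⟩ := intermediate_value_Icc hr (hc.mono Set.Icc_subset_Iic_self)
    ⟨hle, h0.le⟩
  exact (har.trans_le hx.1).ne (hu x hfx hx.2).symm

/-- Where `k = 1`, the solution is `ℓ eʳ`. -/
theorem eq_mul_exp_of_kbump_eq_one {ℓ t ε : ℝ} {f : ℝ → ℝ} (hε : 0 < ε)
    (hd : ∀ r, HasDerivAt f (deriv f r) r)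
    (hd' : ∀ r, HasDerivAt (deriv f) (kbump t ε r * f r) r) (hf0 : f 0 = ℓ)
    (hf0' : deriv f 0 = ℓ) {r : ℝ} (hr : -ε / 2 ≤ r) : f r = ℓ * Real.exp r := by
  have hconst : ∀ F : ℝ → ℝ, (∀ x, -ε / 2 ≤ x → HasDerivAt F 0 x) →
      ∀ x, -ε / 2 ≤ x → F x = F 0 := fun F hF => by
    have key : ∀ x, -ε / 2 ≤ x → F x = F (-ε / 2) := fun x hx =>
      constant_of_has_deriv_right_zero
        (fun y hy => (hF y hy.1).continuousAt.continuousWithinAt)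
        (fun y hy => (hF y hy.1).hasDerivWithinAt) x ⟨hx, le_rfl⟩
    intro x hx
    rw [key x hx, key 0 (by linarith)]
  have h1 : ∀ x, -ε / 2 ≤ x → deriv f x = f x := fun x hx => by
    have := hconst (fun x => (deriv f x - f x) * Real.exp x) (fun y hy => by
      refine (((hd' y).sub (hd y)).mul (Real.hasDerivAt_exp y)).congr_deriv ?_
      rw [kbump_eq_one hε hy]
      simp only [Pi.sub_apply]
      ring) x hx
    simp only [hf0, hf0', sub_self, zero_mul, mul_eq_zero, (Real.exp_pos x).ne', or_false] at this
    linarith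
  have := hconst (fun x => f x * Real.exp (-x)) (fun y hy => by
    refine ((hd y).mul ((hasDerivAt_neg y).exp)).congr_deriv ?_
    rw [h1 y hy]
    ring) r hr
  simp only [hf0, neg_zero, Real.exp_zero, mul_one] at this
  rw [← this, mul_assoc, ← Real.exp_add, neg_add_cancel, Real.exp_zero, mul_one]

theorem isShot_of_contDiff {ℓ t ε a : ℝ} {f : ℝ → ℝ} (hℓ : 0 < ℓ) (ht : t ∈ Set.Ioo (0 : ℝ) 1)
    (hε : 0 < ε) (hf : ContDiff ℝ 2 f) (hode : ∀ r, deriv (deriv f) r = kbump t ε r * f r)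
    (hf0 : f 0 = ℓ) (hf0' : deriv f 0 = ℓ) (hroot : f a = 0) (hu : ∀ r, f r = 0 → r = a) :
    IsShot ℓ (kbump t ε) f (deriv f) a ∧ a < -ε / 2 := by
  have hf' : ContDiff ℝ 1 (deriv f) := ((contDiff_succ_iff_deriv (n := 1)).1 hf).2.2
  have hd : ∀ r, HasDerivAt f (deriv f r) r := fun r =>
    ((hf.differentiable (by norm_num)) r).hasDerivAt
  have hd' : ∀ r, HasDerivAt (deriv f) (kbump t ε r * f r) r := fun r =>
    hode r ▸ ((hf'.differentiable (by norm_num)) r).hasDerivAt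
  have ha : a < -ε / 2 := by
    by_contra! h
    have := eq_mul_exp_of_kbump_eq_one hε hd hd' hf0 hf0' h
    rw [hroot] at this
    exact (mul_pos hℓ (Real.exp_pos a)).ne this
  exact ⟨{
    cont := hf.continuous.continuousOn
    cont' := hf'.continuous.continuousOn
    hasDeriv := fun r _ => hd r
    hasDeriv' := fun r _ => hd' r
    at_zero := hf0
    at_zero' := hf0'
    neg := by linarith
    root := hroot
    pos := fun r h1 h2 => pos_of_root_unique hf.continuous.continuousOn (hf0 ▸ hℓ)
      (fun r hr _ => hu r hr) h1 h2
    k_nonneg := fun r hr => ht.1.le.trans (le_kbump ht hε.le hr.le)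
    k_le_one := fun r hr => kbump_le_one ht hε.le hr.le }, ha⟩

theorem exists_isShot_zero {ℓ t a : ℝ} {f : ℝ → ℝ} (hℓ : 0 < ℓ) (ht : t ∈ Set.Ioo (0 : ℝ) 1)
    (hf : ∀ r, f r = if 0 ≤ r then ℓ * Real.exp r
        else ℓ * Real.cosh (r * Real.sqrt t) +
          (ℓ / Real.sqrt t) * Real.sinh (r * Real.sqrt t))
    (hroot : f a = 0) (hu : ∀ r, f r = 0 → r = a) :
    ∃ g s, IsShot ℓ (kbump t 0) g s a ∧ s a = deriv f a ∧ a < 0 := by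
  have hs : 0 < Real.sqrt t := Real.sqrt_pos.2 ht.1
  set q := Real.sqrt t with hq
  have hqq : q * q = t := Real.mul_self_sqrt ht.1.le
  have ha : a < 0 := by
    by_contra! h
    rw [hf, if_pos h] at hroot
    exact (mul_pos hℓ (Real.exp_pos a)).ne' hroot
  have hd : ∀ r, HasDerivAt (fun r => ℓ * Real.cosh (r * q) + (ℓ / q) * Real.sinh (r * q))
      (ℓ * q * Real.sinh (r * q) + ℓ * Real.cosh (r * q)) r := fun r => by
    have h1 : HasDerivAt (fun r : ℝ => r * q) q r := by
      simpa using (hasDerivAt_id r).mul_const q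
    refine ((h1.cosh.const_mul ℓ).add (h1.sinh.const_mul (ℓ / q))).congr_deriv ?_
    field_simp
  have hd' : ∀ r, HasDerivAt (fun r => ℓ * q * Real.sinh (r * q) + ℓ * Real.cosh (r * q))
      (t * (ℓ * Real.cosh (r * q) + (ℓ / q) * Real.sinh (r * q))) r := fun r => by
    have h1 : HasDerivAt (fun r : ℝ => r * q) q r := by
      simpa using (hasDerivAt_id r).mul_const q
    refine ((h1.sinh.const_mul (ℓ * q)).add (h1.cosh.const_mul ℓ)).congr_deriv ?_
    rw [← hqq]
    field_simp
  have hfg : ∀ r ≤ 0, f r = ℓ * Real.cosh (r * q) + (ℓ / q) * Real.sinh (r * q) := fun r hr => by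
    rw [hf]
    split_ifs with h
    · simp [le_antisymm hr h]
    · rfl
  have hcont := fun r => (hd r).continuousAt.continuousWithinAt (s := Set.Iic (0 : ℝ))
  refine ⟨_, _, {
    cont := fun r _ => hcont r
    cont' := fun r _ => (hd' r).continuousAt.continuousWithinAt
    hasDeriv := fun r _ => hd r
    hasDeriv' := fun r hr => (hd' r).congr_deriv (by rw [kbump_zero t hr.le])
    at_zero := by simp
    at_zero' := by simp
    neg := ha
    root := (hfg a ha.le).symm.trans hroot
    pos := fun r h1 h2 => pos_of_root_unique (fun r _ => hcont r) (by simpa using hℓ)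
      (fun r hr h0 => hu r ((hfg r h0).trans hr)) h1 h2
    k_nonneg := fun r hr => ht.1.le.trans (le_kbump ht le_rfl hr.le)
    k_le_one := fun r hr => kbump_le_one ht le_rfl hr.le }, ?_, ha⟩
  refine ((hd a).congr_of_eventuallyEq ?_).deriv.symm
  filter_upwards [Iio_mem_nhds ha] with r hr
  exact hfg r hr.le

theorem kbump_mono {p q : ℝ × ℝ} (hp : p ∈ Set.Ioo (0 : ℝ) 1 ×ˢ Set.Ici (0 : ℝ))
    (hq : q ∈ Set.Ioo (0 : ℝ) 1 ×ˢ Set.Ici (0 : ℝ)) (hpq : p ≤ q) {r : ℝ} (hr : r < 0) :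
    kbump p.1 p.2 r ≤ kbump q.1 q.2 r :=
  (kbump_mono_left hpq.1 hp.2 hr.le).trans (kbump_mono_right hq.1 hp.2 hpq.2 hr.le)

theorem slope_sub_le_integral_kbump {ℓ : ℝ} {p q : ℝ × ℝ} {g₁ s₁ g₂ s₂ : ℝ → ℝ} {a₁ a₂ b M : ℝ}
    (hp : p ∈ Set.Ioo (0 : ℝ) 1 ×ˢ Set.Ici (0 : ℝ))
    (hq : q ∈ Set.Ioo (0 : ℝ) 1 ×ˢ Set.Ici (0 : ℝ)) (hpq : p ≤ q)
    (h₁ : IsShot ℓ (kbump p.1 p.2) g₁ s₁ a₁) (h₂ : IsShot ℓ (kbump q.1 q.2) g₂ s₂ a₂)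
    (hm : 0 ≤ s₂ a₂) (hM : 0 < M) (hM₁ : M ≤ s₁ a₁) (hb : b ≤ a₁) :
    s₁ a₁ - s₂ a₂ ≤ (ℓ + ℓ ^ 2 / M * (1 + -b)) *
      ((∫ r in (0 : ℝ)..b, kbump p.1 p.2 r) - ∫ r in (0 : ℝ)..b, kbump q.1 q.2 r) := by
  have hb₀ : b < 0 := hb.trans_lt h₁.neg
  have hℓ := h₁.level_pos
  set P : ℝ → ℝ := fun x => (∫ r in (0 : ℝ)..x, kbump q.1 q.2 r) -
    ∫ r in (0 : ℝ)..x, kbump p.1 p.2 r with hPdef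
  have hPc : ContinuousOn P (Set.Icc b 0) :=
    (continuousOn_integral_kbump q.1 hq.2 hb₀.le).sub (continuousOn_integral_kbump p.1 hp.2 hb₀.le)
  have hPd : ∀ r < 0, HasDerivAt P (kbump q.1 q.2 r - kbump p.1 p.2 r) r := fun r hr =>
    (hasDerivAt_integral_kbump q.1 hq.2 hr).sub (hasDerivAt_integral_kbump p.1 hp.2 hr)
  have hmono : P b ≤ P a₁ := monotoneOn_Icc_of_hasDerivAt_nonneg hPc (fun r hr => hPd r hr.2)
    (fun r hr => sub_nonneg.2 (kbump_mono hp hq hpq hr.2)) ⟨le_rfl, hb₀.le⟩ ⟨hb, h₁.neg.le⟩ hb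
  refine (h₁.slope_sub_le h₂ (fun r hr => kbump_mono hp hq hpq hr) hm
    (hPc.mono (Set.Icc_subset_Icc_left hb)) (by simp [hPdef]) hPd hM hM₁
    (neg_le_neg hb)).trans ?_
  refine mul_le_mul_of_nonneg_left ?_ ?_
  · have : P b = (∫ r in (0 : ℝ)..b, kbump q.1 q.2 r) - ∫ r in (0 : ℝ)..b, kbump p.1 p.2 r := rfl
    linarith
  · have : 0 < -b := neg_pos.2 hb₀
    positivity

/-- The `C²` solutions and the explicit limit solution are all shots. -/
theorem exists_isShot {ℓ t ε a : ℝ} {f : ℝ → ℝ} (hℓ : 0 < ℓ) (ht : t ∈ Set.Ioo (0 : ℝ) 1)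
    (hε : 0 ≤ ε) (hf : 0 < ε → ContDiff ℝ 2 f)
    (hode : 0 < ε → ∀ r, deriv (deriv f) r = kbump t ε r * f r)
    (hf0 : 0 < ε → f 0 = ℓ) (hf0' : 0 < ε → deriv f 0 = ℓ)
    (hfzero : ε = 0 → ∀ r, f r = if 0 ≤ r then ℓ * Real.exp r
        else ℓ * Real.cosh (r * Real.sqrt t) +
          (ℓ / Real.sqrt t) * Real.sinh (r * Real.sqrt t))
    (hroot : f a = 0) (hu : ∀ r, f r = 0 → r = a) :
    ∃ g s, IsShot ℓ (kbump t ε) g s a ∧ s a = deriv f a ∧ a < -ε / 2 ∧ 0 < deriv f a := by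
  suffices ∃ g s, IsShot ℓ (kbump t ε) g s a ∧ s a = deriv f a ∧ a < -ε / 2 by
    obtain ⟨g, s, h, hs, ha⟩ := this
    obtain ⟨c, hac, hc⟩ := exists_between ha
    exact ⟨g, s, h, hs, ha, hs ▸ h.slope_pos ⟨hac, by linarith⟩ (kbump_lt_one ht hε hc)⟩
  rcases hε.eq_or_lt with rfl | h
  · obtain ⟨g, s, h, hs, ha⟩ := exists_isShot_zero hℓ ht (hfzero rfl) hroot hu
    exact ⟨g, s, h, hs, by simpa using ha⟩
  · obtain ⟨h1, h2⟩ := isShot_of_contDiff hℓ ht h (hf h) (hode h) (hf0 h) (hf0' h) hroot hu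
    exact ⟨f, deriv f, h1, rfl, h2⟩

/-- Lemma 4.4 (b) of Futer–Kalfagianni–Purcell: with `f t ε` the `C²`
solution of `f'' = k_{t,ε}·f`, `f(0) = f'(0) = ℓ₁` for `ε > 0`, and
`f t 0` the explicit limit solution, `r₀ t ε` the unique zero of `f t ε`,
and `m t ε = (f t ε)'(r₀ t ε)`, the function `m` is continuous on
`(0,1) × [0,∞)` and strictly decreasing in each of its two variables. -/
theorem stmt_18 (ℓ₁ : ℝ) (hℓ : 0 < ℓ₁)
    (f : ℝ → ℝ → ℝ → ℝ) (r₀ : ℝ → ℝ → ℝ)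
    (hfC2 : ∀ t ∈ Set.Ioo (0 : ℝ) 1, ∀ ε > 0, ContDiff ℝ 2 (f t ε))
    (hode : ∀ t ∈ Set.Ioo (0 : ℝ) 1, ∀ ε > 0,
      ∀ r, deriv (deriv (f t ε)) r = kbump t ε r * f t ε r)
    (hf0 : ∀ t ∈ Set.Ioo (0 : ℝ) 1, ∀ ε > 0, f t ε 0 = ℓ₁)
    (hf'0 : ∀ t ∈ Set.Ioo (0 : ℝ) 1, ∀ ε > 0, deriv (f t ε) 0 = ℓ₁)
    (hfzero : ∀ t ∈ Set.Ioo (0 : ℝ) 1, ∀ r,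
      f t 0 r = if 0 ≤ r then ℓ₁ * Real.exp r
        else ℓ₁ * Real.cosh (r * Real.sqrt t) +
          (ℓ₁ / Real.sqrt t) * Real.sinh (r * Real.sqrt t))
    (hroot : ∀ t ∈ Set.Ioo (0 : ℝ) 1, ∀ ε ≥ 0, f t ε (r₀ t ε) = 0)
    (hrootu : ∀ t ∈ Set.Ioo (0 : ℝ) 1, ∀ ε ≥ 0,
      ∀ r, f t ε r = 0 → r = r₀ t ε)
    (m : ℝ → ℝ → ℝ) (hm : ∀ t ε, m t ε = deriv (f t ε) (r₀ t ε)) :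
    ContinuousOn (fun p : ℝ × ℝ => m p.1 p.2)
      (Set.Ioo (0 : ℝ) 1 ×ˢ Set.Ici (0 : ℝ)) ∧
    (∀ ε ∈ Set.Ici (0 : ℝ), StrictAntiOn (fun t => m t ε) (Set.Ioo 0 1)) ∧
    (∀ t ∈ Set.Ioo (0 : ℝ) 1, StrictAntiOn (fun ε => m t ε) (Set.Ici 0)) := by
  have H : ∀ p ∈ Set.Ioo (0 : ℝ) 1 ×ˢ Set.Ici (0 : ℝ), ∃ g s,
      IsShot ℓ₁ (kbump p.1 p.2) g s (r₀ p.1 p.2) ∧ s (r₀ p.1 p.2) = m p.1 p.2 ∧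
        r₀ p.1 p.2 < -p.2 / 2 ∧ 0 < m p.1 p.2 := by
    rintro ⟨t, ε⟩ ⟨ht, hε⟩
    simp only [hm]
    refine exists_isShot hℓ ht hε (hfC2 t ht ε) (hode t ht ε) (hf0 t ht ε) (hf'0 t ht ε) ?_
      (hroot t ht ε hε) (hrootu t ht ε hε)
    rintro rfl
    exact hfzero t ht
  have hanti : ∀ p ∈ Set.Ioo (0 : ℝ) 1 ×ˢ Set.Ici (0 : ℝ),
      ∀ q ∈ Set.Ioo (0 : ℝ) 1 ×ˢ Set.Ici (0 : ℝ), p ≤ q →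
        r₀ q.1 q.2 ≤ r₀ p.1 p.2 ∧ m q.1 q.2 ≤ m p.1 p.2 := fun p hp q hq hpq => by
    obtain ⟨_, _, h₁, hs₁, -, -⟩ := H p hp
    obtain ⟨_, _, h₂, hs₂, -, -⟩ := H q hq
    have hk : ∀ r < 0, kbump p.1 p.2 r ≤ kbump q.1 q.2 r := fun r hr => kbump_mono hp hq hpq hr
    exact ⟨h₁.root_le h₂ hk, hs₁ ▸ hs₂ ▸ h₁.slope_le_slope h₂ hk⟩
  have hstrict : ∀ p ∈ Set.Ioo (0 : ℝ) 1 ×ˢ Set.Ici (0 : ℝ),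
      ∀ q ∈ Set.Ioo (0 : ℝ) 1 ×ˢ Set.Ici (0 : ℝ), p ≤ q →
        ∀ c ∈ Set.Ioo (r₀ p.1 p.2) 0, kbump p.1 p.2 c < kbump q.1 q.2 c →
          m q.1 q.2 < m p.1 p.2 := fun p hp q hq hpq c hc hlt => by
    obtain ⟨_, _, h₁, hs₁, -, -⟩ := H p hp
    obtain ⟨_, _, h₂, hs₂, -, -⟩ := H q hq
    exact hs₁ ▸ hs₂ ▸ h₁.slope_lt_slope h₂ (fun r hr => kbump_mono hp hq hpq hr) hc hlt
  refine ⟨fun c hc => ?_, fun ε hε t ht s hs hts => ?_, fun t ht ε hε δ hδ hεδ => ?_⟩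
  · obtain ⟨_, _, h, hs, -, hmc⟩ := H c hc
    set I : ℝ × ℝ → ℝ := fun q => ∫ r in (0 : ℝ)..r₀ c.1 c.2, kbump q.1 q.2 r with hI
    set C := ℓ₁ + ℓ₁ ^ 2 / m c.1 c.2 * (1 + -r₀ c.1 c.2)
    have hIc : Filter.Tendsto I (nhdsWithin c (Set.Ioo (0 : ℝ) 1 ×ˢ Set.Ici (0 : ℝ)))
        (nhds (I c)) := continuousWithinAt_integral_kbump h.neg.le hc.2
    have hsup : ∀ q ∈ Set.Ioo (0 : ℝ) 1 ×ˢ Set.Ici (0 : ℝ),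
        q ⊔ c ∈ Set.Ioo (0 : ℝ) 1 ×ˢ Set.Ici (0 : ℝ) := fun q hq =>
      ⟨⟨lt_sup_of_lt_left hq.1.1, sup_lt_iff.2 ⟨hq.1.2, hc.1.2⟩⟩,
        Set.mem_Ici.2 (le_sup_of_le_left (Set.mem_Ici.1 hq.2))⟩
    have hinf : ∀ q ∈ Set.Ioo (0 : ℝ) 1 ×ˢ Set.Ici (0 : ℝ),
        q ⊓ c ∈ Set.Ioo (0 : ℝ) 1 ×ˢ Set.Ici (0 : ℝ) := fun q hq =>
      ⟨⟨lt_inf_iff.2 ⟨hq.1.1, hc.1.1⟩, inf_lt_of_left_lt hq.1.2⟩,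
        Set.mem_Ici.2 (le_inf hq.2 hc.2)⟩
    have hIsup : Filter.Tendsto (fun q => I (q ⊔ c))
        (nhdsWithin c (Set.Ioo (0 : ℝ) 1 ×ˢ Set.Ici (0 : ℝ))) (nhds (I c)) := by
      refine hIc.comp (tendsto_nhdsWithin_iff.2 ⟨?_, ?_⟩)
      · have : Continuous fun q : ℝ × ℝ => q ⊔ c :=
          (continuous_fst.max continuous_const).prodMk (continuous_snd.max continuous_const)
        simpa using (this.tendsto c).mono_left nhdsWithin_le_nhds
      · filter_upwards [self_mem_nhdsWithin] with q hq using hsup q hq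
    have hIinf : Filter.Tendsto (fun q => I (q ⊓ c))
        (nhdsWithin c (Set.Ioo (0 : ℝ) 1 ×ˢ Set.Ici (0 : ℝ))) (nhds (I c)) := by
      refine hIc.comp (tendsto_nhdsWithin_iff.2 ⟨?_, ?_⟩)
      · have : Continuous fun q : ℝ × ℝ => q ⊓ c :=
          (continuous_fst.min continuous_const).prodMk (continuous_snd.min continuous_const)
        simpa using (this.tendsto c).mono_left nhdsWithin_le_nhds
      · filter_upwards [self_mem_nhdsWithin] with q hq using hinf q hq
    have hlow : Filter.Tendsto (fun q => m c.1 c.2 - C * (I c - I (q ⊔ c)))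
        (nhdsWithin c (Set.Ioo (0 : ℝ) 1 ×ˢ Set.Ici (0 : ℝ))) (nhds (m c.1 c.2)) := by
      simpa using (((hIsup.const_sub (I c)).const_mul C).const_sub (m c.1 c.2))
    have hupp : Filter.Tendsto (fun q => m c.1 c.2 + C * (I (q ⊓ c) - I c))
        (nhdsWithin c (Set.Ioo (0 : ℝ) 1 ×ˢ Set.Ici (0 : ℝ))) (nhds (m c.1 c.2)) := by
      simpa using (((hIinf.sub_const (I c)).const_mul C).const_add (m c.1 c.2))
    refine tendsto_of_tendsto_of_tendsto_of_le_of_le' hlow hupp ?_ ?_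
    · filter_upwards [self_mem_nhdsWithin] with q hq
      obtain ⟨_, _, h₂, hs₂, -, hm₂⟩ := H _ (hsup q hq)
      have h3 := slope_sub_le_integral_kbump hc (hsup q hq) le_sup_right h h₂ (hs₂ ▸ hm₂.le)
        hmc hs.ge le_rfl
      rw [hs, hs₂] at h3
      have h4 := (hanti q hq _ (hsup q hq) le_sup_left).2
      linarith
    · filter_upwards [self_mem_nhdsWithin] with q hq
      obtain ⟨_, _, h₁, hs₁, -, -⟩ := H _ (hinf q hq)
      have h5 := hanti _ (hinf q hq) c hc inf_le_right
      have h3 := slope_sub_le_integral_kbump (hinf q hq) hc inf_le_right h₁ h (hs ▸ hmc.le) hmc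
        (hs₁ ▸ h5.2) h5.1
      rw [hs, hs₁] at h3
      have h4 := (hanti _ (hinf q hq) q hq inf_le_left).2
      linarith
  · obtain ⟨_, _, -, -, ha, -⟩ := H (t, ε) ⟨ht, hε⟩
    obtain ⟨c, hac, hc⟩ := exists_between ha
    exact hstrict (t, ε) ⟨ht, hε⟩ (s, ε) ⟨hs, hε⟩ ⟨hts.le, le_rfl⟩ c
      ⟨hac, by linarith [Set.mem_Ici.1 hε]⟩ (kbump_lt_left hts hε hc)
  · obtain ⟨_, _, -, -, ha, -⟩ := H (t, ε) ⟨ht, hε⟩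
    have hε' := Set.mem_Ici.1 hε
    obtain ⟨c, hac, hc⟩ := exists_between (max_lt ha (show -δ < -ε / 2 by linarith))
    exact hstrict (t, ε) ⟨ht, hε⟩ (t, δ) ⟨ht, hδ⟩ ⟨le_rfl, hεδ.le⟩ c
      ⟨(le_max_left _ _).trans_lt hac, by linarith⟩
      (kbump_lt_right ht hε hεδ hc ((le_max_right _ _).trans_lt hac))
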